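/- arXiv:0711.1592 — 5 statements merged into one kernel-verified Lean document; each statement's English description precedes it below -/
import Mathlib

section
/- The Dedekind eta function satisfies the modular transformation law η(−1/τ) = √(τ/i)·η(τ) for all τ in the upper half plane, where the square root is the principal branch. -/
open Complex

noncomputable def dedekindEta (τ : ℂ) : ℂ :=
  Complex.exp (Real.pi * I * τ / 12)
    * ∏' n : ℕ, (1 - Complex.exp (2 * Real.pi * I * τ * (n + 1)))

lemma dedekindEta_eq_eta (z : ℂ) : dedekindEta z = ModularForm.eta z := by
  unfold dedekindEta ModularForm.eta
  congr 1
  · rw [Function.Periodic.qParam]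
    congr 1
    push_cast
    ring
  · refine tprod_congr fun n => ?_
    rw [ModularForm.eta_q_eq_cexp]
    congr 2
    ring

lemma cpow_half_div_I (τ : ℂ) (hτ : 0 < τ.im) :
    τ ^ ((1 : ℂ) / 2) = (τ / I) ^ ((1 : ℂ) / 2) * I ^ ((1 : ℂ) / 2) := by
  have h0 : τ / I ≠ 0 := by
    refine div_ne_zero ?_ I_ne_zero
    rintro rfl
    simp at hτ
  have hre : 0 < (τ / I).re := by simpa [Complex.div_I] using hτ
  have ha := abs_lt.mp (Complex.abs_arg_lt_pi_div_two_iff.mpr (Or.inl hre))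
  have hl : Complex.log (τ / I * I) = Complex.log (τ / I) + Complex.log I := by
    apply Complex.log_mul h0 I_ne_zero
    rw [Complex.arg_I]
    constructor <;> linarith [ha.1, ha.2, Real.pi_pos]
  rw [div_mul_cancel₀ _ I_ne_zero] at hl
  have ht : τ ≠ 0 := by
    rintro rfl
    simp at hτ
  rw [Complex.cpow_def_of_ne_zero ht, Complex.cpow_def_of_ne_zero h0,
    Complex.cpow_def_of_ne_zero I_ne_zero, hl, ← Complex.exp_add]
  congr 1
  ring

theorem dedekind_eta_modular (τ : ℂ) (hτ : 0 < τ.im) :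
    dedekindEta (-1 / τ) = (τ / I) ^ ((1 : ℂ) / 2) * dedekindEta τ := by
  have h := ModularForm.eta_comp_eq_csqrt_I_inv (show τ ∈ UpperHalfPlane.upperHalfPlaneSet from hτ)
  simp only [Function.comp, Pi.smul_apply, Pi.mul_apply, smul_eq_mul] at h
  have hI : I ^ ((1 : ℂ) / 2) ≠ 0 := by simp [Complex.cpow_eq_zero_iff]
  have hs : ∀ z : ℂ, Complex.sqrt z = z ^ ((1 : ℂ) / 2) := by
    intro z
    simp [Complex.sqrt]
  rw [dedekindEta_eq_eta, dedekindEta_eq_eta, h, hs, hs, cpow_half_div_I τ hτ]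
  field_simp
end

section
/- Schlömilch–Ramanujan formula: ∑_{n=1}^∞ n/(e^{2πn} − 1) = 1/24 − 1/(8π). -/
theorem schlomilch_ramanujan :
    ∑' n : ℕ, ((n : ℝ) + 1) / (Real.exp (2 * Real.pi * ((n : ℝ) + 1)) - 1)
      = 1 / 24 - 1 / (8 * Real.pi) := by
  have hS : ModularGroup.S • UpperHalfPlane.I = UpperHalfPlane.I := by
    rw [UpperHalfPlane.modular_S_smul, UpperHalfPlane.ext_iff]
    simp
  have h1 := EisensteinSeries.G2_S_transform UpperHalfPlane.I
  rw [hS] at h1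
  have h2 := EisensteinSeries.G2_eq_tsum_cexp UpperHalfPlane.I
  rw [riemannZeta_two, ← tsum_pow_div_one_sub_eq_tsum_sigma
    (UpperHalfPlane.norm_exp_two_pi_I_lt_one _),
    tsum_pnat_eq_tsum_succ (f := fun n : ℕ ↦ (n : ℂ) ^ 1 *
      Complex.exp (2 * Real.pi * Complex.I * (UpperHalfPlane.I : ℂ)) ^ n /
      (1 - Complex.exp (2 * Real.pi * Complex.I * (UpperHalfPlane.I : ℂ)) ^ n))] at h2
  have hG : EisensteinSeries.G2 UpperHalfPlane.I = Real.pi := by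
    rw [UpperHalfPlane.coe_I, Complex.I_sq, mul_div_assoc, div_self Complex.I_ne_zero] at h1
    linear_combination h1 / 2
  have hT : ∀ n : ℕ, ((n + 1 : ℕ) : ℂ) ^ 1 *
      Complex.exp (2 * Real.pi * Complex.I * (UpperHalfPlane.I : ℂ)) ^ (n + 1) /
      (1 - Complex.exp (2 * Real.pi * Complex.I * (UpperHalfPlane.I : ℂ)) ^ (n + 1)) =
      ((((n : ℝ) + 1) / (Real.exp (2 * Real.pi * ((n : ℝ) + 1)) - 1) : ℝ) : ℂ) := by
    intro n
    have e : Complex.exp (2 * Real.pi * Complex.I * (UpperHalfPlane.I : ℂ)) ^ (n + 1) =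
        (((Real.exp (2 * Real.pi * ((n : ℝ) + 1)))⁻¹ : ℝ) : ℂ) := by
      rw [← Real.exp_neg, ← Complex.exp_nat_mul, Complex.ofReal_exp, UpperHalfPlane.coe_I]
      congr 1
      push_cast
      linear_combination (2 * Real.pi * ((n : ℂ) + 1)) * Complex.I_mul_I
    rw [e]
    have hp : 1 < Real.exp (2 * Real.pi * ((n : ℝ) + 1)) :=
      Real.one_lt_exp_iff.mpr (by positivity)
    generalize Real.exp (2 * Real.pi * ((n : ℝ) + 1)) = x at hp
    have h0 : x ≠ 0 := by positivity
    have h3 : x - 1 ≠ 0 := by linarith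
    have h4 : 1 - x⁻¹ ≠ 0 := by
      have := inv_lt_one_of_one_lt₀ hp
      linarith
    norm_cast
    push_cast
    rw [pow_one, div_eq_div_iff h4 h3]
    field_simp
  simp only [hT] at h2
  rw [← Complex.ofReal_tsum, hG] at h2
  generalize (∑' n : ℕ, ((n : ℝ) + 1) / (Real.exp (2 * Real.pi * ((n : ℝ) + 1)) - 1)) = s at h2 ⊢
  have h5 : Real.pi = 2 * (Real.pi ^ 2 / 6) - 8 * Real.pi ^ 2 * s := by exact_mod_cast h2
  have hpi := Real.pi_ne_zero
  have h6 : Real.pi * (8 * Real.pi * s) = Real.pi * (Real.pi / 3 - 1) := by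
    linear_combination h5
  have h7 := mul_left_cancel₀ hpi h6
  field_simp
  linear_combination 24 * h7
end

section
/- For every real a > 0, (π/12)(a^{−1} + a) − 1/2 = 2π ∑_{n=1}^∞ [ (n/a)/(e^{2πn/a} − 1) + (na)/(e^{2πna} − 1) ]. -/
open Complex in
lemma aux_term (b : ℝ) (hb : 0 < b) (n : ℕ) :
    ((n + 1 : ℕ) : ℝ) ^ 1 * (Real.exp (-(2 * Real.pi * b))) ^ (n + 1) /
      (1 - (Real.exp (-(2 * Real.pi * b))) ^ (n + 1))
    = ((n : ℝ) + 1) / (Real.exp (2 * Real.pi * ((n : ℝ) + 1) * b) - 1) := by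
  have hp := Real.pi_pos
  rw [← Real.exp_nat_mul]
  have h1 : ((n + 1 : ℕ) : ℝ) * -(2 * Real.pi * b) = -(2 * Real.pi * ((n : ℝ) + 1) * b) := by
    push_cast; ring
  rw [h1, Real.exp_neg]
  have h2 : 1 < Real.exp (2 * Real.pi * ((n : ℝ) + 1) * b) := by
    rw [Real.one_lt_exp_iff]; positivity
  generalize Real.exp (2 * Real.pi * ((n : ℝ) + 1) * b) = x at h2
  have : x - 1 ≠ 0 := by linarith
  have : x ≠ 0 := by linarith
  have : 1 - x⁻¹ ≠ 0 := by
    have := inv_lt_one_of_one_lt₀ h2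
    linarith
  push_cast
  field_simp

lemma aux_lt (b : ℝ) (hb : 0 < b) : ‖Real.exp (-(2 * Real.pi * b))‖ < 1 := by
  have hp := Real.pi_pos
  rw [Real.norm_eq_abs, Real.abs_exp, Real.exp_lt_one_iff]
  have : 0 < 2 * Real.pi * b := by positivity
  linarith

lemma aux_summable (b : ℝ) (hb : 0 < b) :
    Summable fun n : ℕ => ((n : ℝ) + 1) / (Real.exp (2 * Real.pi * ((n : ℝ) + 1) * b) - 1) := by
  have h := summable_norm_pow_mul_geometric_div_one_sub 1 (aux_lt b hb)
  rw [← summable_nat_add_iff 1] at h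
  exact h.congr fun n => aux_term b hb n

lemma aux_G2 (b : ℝ) (hb : 0 < b) (z : UpperHalfPlane) (hz : (z : ℂ) = b * Complex.I) :
    EisensteinSeries.G2 z = ((Real.pi ^ 2 / 3 - 8 * Real.pi ^ 2 *
      ∑' n : ℕ, ((n : ℝ) + 1) / (Real.exp (2 * Real.pi * ((n : ℝ) + 1) * b) - 1) : ℝ) : ℂ) := by
  have hq : Complex.exp (2 * Real.pi * Complex.I * z)
      = ((Real.exp (-(2 * Real.pi * b)) : ℝ) : ℂ) := by
    rw [hz]
    push_cast
    congr 1
    linear_combination (2 * (Real.pi : ℂ) * b) * Complex.I_mul_I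
  rw [EisensteinSeries.G2_eq_tsum_cexp, hq, riemannZeta_two,
    ← tsum_pow_div_one_sub_eq_tsum_sigma (by rw [Complex.norm_real]; exact aux_lt b hb),
    tsum_pnat_eq_tsum_succ (f := fun n : ℕ => (n : ℂ) ^ 1 *
      ((Real.exp (-(2 * Real.pi * b)) : ℝ) : ℂ) ^ n /
      (1 - ((Real.exp (-(2 * Real.pi * b)) : ℝ) : ℂ) ^ n))]
  rw [← tsum_congr (aux_term b hb)]
  push_cast
  ring

theorem ramanujan_symmetric_identity (a : ℝ) (ha : 0 < a) :
    Real.pi / 12 * (a⁻¹ + a) - 1 / 2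
      = 2 * Real.pi * ∑' n : ℕ,
          ((((n : ℝ) + 1) / a) / (Real.exp (2 * Real.pi * ((n : ℝ) + 1) / a) - 1)
            + (((n : ℝ) + 1) * a) / (Real.exp (2 * Real.pi * ((n : ℝ) + 1) * a) - 1)) := by
  have hai : 0 < a⁻¹ := inv_pos.mpr ha
  have hac : (a : ℂ) ≠ 0 := by exact_mod_cast ha.ne'
  have h1 := (aux_summable a ha).mul_left a
  have h2 := (aux_summable a⁻¹ hai).mul_left a⁻¹
  have e : ∀ n : ℕ, ((((n : ℝ) + 1) / a) / (Real.exp (2 * Real.pi * ((n : ℝ) + 1) / a) - 1)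
            + (((n : ℝ) + 1) * a) / (Real.exp (2 * Real.pi * ((n : ℝ) + 1) * a) - 1))
      = a⁻¹ * (((n : ℝ) + 1) / (Real.exp (2 * Real.pi * ((n : ℝ) + 1) * a⁻¹) - 1))
        + a * (((n : ℝ) + 1) / (Real.exp (2 * Real.pi * ((n : ℝ) + 1) * a) - 1)) := by
    intro n
    rw [div_eq_mul_inv (2 * Real.pi * ((n : ℝ) + 1)) a]
    ring
  rw [tsum_congr e, h2.tsum_add h1, tsum_mul_left, tsum_mul_left]
  let z : UpperHalfPlane := ⟨a * Complex.I, by simpa using ha⟩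
  have hz : (z : ℂ) = a * Complex.I := rfl
  have hS : ((ModularGroup.S • z : UpperHalfPlane) : ℂ) = (a⁻¹ : ℝ) * Complex.I := by
    rw [UpperHalfPlane.modular_S_smul]
    change (-(z : ℂ))⁻¹ = _
    rw [hz, inv_eq_iff_eq_inv, mul_inv, Complex.inv_I]
    push_cast
    rw [inv_inv]; ring
  have key := EisensteinSeries.G2_S_transform z
  rw [aux_G2 a ha z hz, aux_G2 a⁻¹ hai _ hS, hz] at key
  generalize (∑' n : ℕ, ((n : ℝ) + 1) / (Real.exp (2 * Real.pi * ((n : ℝ) + 1) * a) - 1)) = A at *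
  generalize (∑' n : ℕ, ((n : ℝ) + 1) / (Real.exp (2 * Real.pi * ((n : ℝ) + 1) * a⁻¹) - 1)) = B at *
  have e1 : (-2 * (Real.pi : ℂ) * Complex.I / (a * Complex.I)) = ((-2 * Real.pi / a : ℝ) : ℂ) := by
    push_cast
    field_simp
  have e2 : (((a : ℂ) * Complex.I) ^ 2)⁻¹ = ((-(a ^ 2)⁻¹ : ℝ) : ℂ) := by
    rw [mul_pow, Complex.I_sq]
    push_cast
    rw [mul_neg_one, inv_neg]
  rw [e1, e2] at key
  rw [← Complex.ofReal_mul, ← Complex.ofReal_sub, Complex.ofReal_inj] at key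
  have hp := Real.pi_pos
  have hp' := hp.ne'
  have ha' := ha.ne'
  field_simp at key ⊢
  linarith
end

section
/- Legendre's integral: for every real a ≠ 0, ∫₀^∞ sin(ax)/(e^{2πx} − 1) dx = (1/4)·(e^a + 1)/(e^a − 1) − 1/(2a). -/
open MeasureTheory Set in
lemma leg_int (a c : ℝ) (hc : 0 < c) :
    IntegrableOn (fun x : ℝ => Real.sin (a * x) * Real.exp (-(c * x))) (Ioi 0) ∧
    ∫ x in Ioi (0:ℝ), Real.sin (a * x) * Real.exp (-(c * x)) = a / (c ^ 2 + a ^ 2) := by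
  have hre : (-(c : ℂ) + a * Complex.I).re < 0 := by simpa using hc
  have hi := integrableOn_exp_mul_complex_Ioi hre 0
  have h1 := integral_exp_mul_complex_Ioi hre 0
  have hf : ∀ x : ℝ, RCLike.im (Complex.exp ((-(c : ℂ) + a * Complex.I) * x))
      = Real.sin (a * x) * Real.exp (-(c * x)) := by
    intro x
    simp [Complex.exp_im, mul_comm]
  have hi2 := Integrable.im hi
  have h2 := integral_im hi
  simp only [hf] at hi2 h2
  refine ⟨hi2, ?_⟩
  rw [h2, h1]
  have h3 : c ^ 2 + a ^ 2 ≠ 0 := by positivity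
  simp [Complex.div_im, Complex.normSq_apply]
  field_simp

open MeasureTheory Set in
lemma leg_norm (a c : ℝ) (hc : 0 < c) :
    ∫ x in Ioi (0:ℝ), ‖Real.sin (a * x) * Real.exp (-(c * x))‖ ≤ |a| * (1 / c ^ 2) := by
  have h1 := Real.integral_rpow_mul_exp_neg_mul_Ioi (a := 2) two_pos hc
  have h2 := integrableOn_rpow_mul_exp_neg_mul_rpow (p := 1) (s := 1) (b := c) (by norm_num)
    one_pos hc
  norm_num at h1
  simp only [Real.rpow_one, neg_mul] at h2
  have h3 : |a| * (1 / c ^ 2) = ∫ x in Ioi (0:ℝ), |a| * (x * Real.exp (-(c * x))) := by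
    rw [integral_const_mul, h1]
    simp
  rw [h3]
  refine setIntegral_mono_on (leg_int a c hc).1.norm (h2.const_mul _) measurableSet_Ioi ?_
  intro x hx
  have hx : 0 < x := hx
  rw [norm_mul, Real.norm_eq_abs, Real.norm_eq_abs, Real.abs_exp, ← mul_assoc]
  gcongr
  calc |Real.sin (a * x)| ≤ |a * x| := Real.abs_sin_le_abs
    _ = |a| * x := by rw [abs_mul, abs_of_pos hx]

lemma leg_geom (x : ℝ) (hx : 0 < x) (s : ℝ) :
    ∑' n : ℕ, s * Real.exp (-(2 * Real.pi * (n + 1) * x)) = s / (Real.exp (2 * Real.pi * x) - 1) := by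
  have hpos : 0 < 2 * Real.pi * x := by positivity
  have hlt : Real.exp (-(2 * Real.pi * x)) < 1 := by
    rw [Real.exp_lt_one_iff]; linarith
  have h : ∀ n : ℕ, s * Real.exp (-(2 * Real.pi * (n + 1) * x))
      = s * Real.exp (-(2 * Real.pi * x)) * Real.exp (-(2 * Real.pi * x)) ^ n := by
    intro n
    rw [← Real.exp_nat_mul, mul_assoc s, ← Real.exp_add]
    congr 2; ring
  simp only [h]
  rw [tsum_mul_left, tsum_geometric_of_lt_one (Real.exp_pos _).le hlt]
  have h1 : 1 < Real.exp (2 * Real.pi * x) := Real.one_lt_exp_iff.mpr hpos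
  have h2 : Real.exp (2 * Real.pi * x) - 1 ≠ 0 := by linarith
  have h3 : Real.exp (2 * Real.pi * x) ≠ 0 := by positivity
  rw [Real.exp_neg]
  have h4 : 1 - (Real.exp (2 * Real.pi * x))⁻¹ = (Real.exp (2 * Real.pi * x) - 1) / Real.exp (2 * Real.pi * x) := by
    field_simp
  rw [h4]
  field_simp

lemma leg_cot (a : ℝ) (ha : a ≠ 0) :
    ∑' n : ℕ, a / ((2 * Real.pi * (n + 1)) ^ 2 + a ^ 2)
      = 1 / 4 * (Real.exp a + 1) / (Real.exp a - 1) - 1 / (2 * a) := by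
  have hpi : (Real.pi : ℂ) ≠ 0 := by exact_mod_cast Real.pi_ne_zero
  have haC : (a : ℂ) ≠ 0 := by exact_mod_cast ha
  set z : ℂ := -(a / (2 * Real.pi) * Complex.I) with hz
  have hzr : z = ((-(a / (2 * Real.pi)) : ℝ) : ℂ) * Complex.I := by rw [hz]; push_cast; ring
  have hzim : z.im ≠ 0 := by
    rw [hzr, Complex.im_ofReal_mul, Complex.I_im, mul_one]
    exact neg_ne_zero.mpr (div_ne_zero ha (by positivity))
  have hmem : z ∈ Complex.integerComplement := by
    rintro ⟨n, hn⟩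
    apply hzim; rw [← hn]; simp
  have h := cot_series_rep' hmem
  have hterm : ∀ n : ℕ, (1 / (z - (n + 1)) + 1 / (z + (n + 1)))
      = (4 * Real.pi * Complex.I) * ((a / ((2 * Real.pi * (n + 1)) ^ 2 + a ^ 2) : ℝ) : ℂ) := by
    intro n
    have e1 : z - (n + 1) ≠ 0 := by
      intro h0; apply hzim; rw [sub_eq_zero.mp h0]; simp
    have e2 : z + (n + 1) ≠ 0 := by
      intro h0; apply hzim; rw [eq_neg_of_add_eq_zero_left h0]; simp
    have e3 : (2 * Real.pi * (n + 1)) ^ 2 + a ^ 2 ≠ 0 := by positivity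
    have e3' : ((2 * Real.pi * (n + 1)) ^ 2 + a ^ 2 : ℂ) ≠ 0 := by exact_mod_cast e3
    have hzm : 2 * Real.pi * z = -(a * Complex.I) := by rw [hz]; field_simp
    have hz2 : (2 * Real.pi * z) ^ 2 = -(a : ℂ) ^ 2 := by
      rw [hzm]; linear_combination (a : ℂ) ^ 2 * Complex.I_sq
    push_cast
    rw [one_div_add_one_div e1 e2, mul_div_assoc', div_eq_div_iff (mul_ne_zero e1 e2) e3']
    have : (a : ℂ) * Complex.I = -(2 * Real.pi * z) := by rw [hzm]; ring
    linear_combination (-2 * z) * hz2 + (-(4 * Real.pi * (z - (n+1)) * (z + (n+1)))) * this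
      + (4 * z) * hz2
  simp only [hterm] at h
  rw [tsum_mul_left, ← Complex.ofReal_tsum, Complex.cot_pi_eq_exp_ratio] at h
  have he : 2 * Real.pi * Complex.I * z = ((a : ℝ) : ℂ) := by
    rw [hz]; field_simp; linear_combination -Complex.I_sq
  rw [he] at h
  have hE : Real.exp a - 1 ≠ 0 := by
    intro h0; apply ha; exact Real.exp_eq_one_iff a |>.mp (by linarith)
  have hEC : (Complex.exp a - 1) ≠ 0 := by exact_mod_cast hE
  have hEC' : (1 - Complex.exp a) ≠ 0 := by
    intro h0; apply hEC; linear_combination -h0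
  have hinv : 1 / z = 2 * Real.pi * Complex.I / a := by
    rw [hz]; field_simp; linear_combination -Complex.I_sq
  rw [hinv] at h
  apply Complex.ofReal_injective
  apply mul_left_cancel₀ (show (4 * Real.pi * Complex.I) ≠ 0 by simp [hpi])
  rw [← h]
  push_cast
  have : (Complex.exp a + 1) / (Complex.I * (1 - Complex.exp a))
      = Complex.I * ((Complex.exp a + 1) / (Complex.exp a - 1)) := by
    rw [mul_div_assoc', div_eq_div_iff (mul_ne_zero Complex.I_ne_zero hEC') hEC]
    linear_combination -(Complex.exp a + 1) * (1 - Complex.exp a) * Complex.I_sq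
  rw [this]
  field_simp
  ring

theorem legendre_integral (a : ℝ) (ha : a ≠ 0) :
    ∫ x in Set.Ioi (0 : ℝ), Real.sin (a * x) / (Real.exp (2 * Real.pi * x) - 1)
      = 1 / 4 * (Real.exp a + 1) / (Real.exp a - 1) - 1 / (2 * a) := by
  have hc : ∀ n : ℕ, 0 < 2 * Real.pi * ((n : ℝ) + 1) := fun n => by positivity
  have hs : Summable fun n : ℕ => |a| * (1 / (2 * Real.pi * ((n : ℝ) + 1)) ^ 2) := by
    have h0 : Summable fun n : ℕ => 1 / ((n : ℝ) + 1) ^ 2 := by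
      have := (summable_nat_add_iff 1).mpr (Real.summable_one_div_nat_pow.mpr one_lt_two)
      simpa using this
    refine (h0.mul_left (|a| * (1 / (2 * Real.pi) ^ 2))).congr fun n => ?_
    field_simp
  have key := MeasureTheory.hasSum_integral_of_summable_integral_norm
    (μ := MeasureTheory.volume.restrict (Set.Ioi (0:ℝ)))
    (F := fun (n : ℕ) (x : ℝ) => Real.sin (a * x) * Real.exp (-(2 * Real.pi * ((n : ℝ) + 1) * x)))
    (fun n => (leg_int a _ (hc n)).1)
    (Summable.of_nonneg_of_le (fun n => MeasureTheory.integral_nonneg fun _ => norm_nonneg _)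
      (fun n => leg_norm a _ (hc n)) hs)
  rw [← leg_cot a ha]
  have k := key.tsum_eq
  simp only [(leg_int a _ (hc _)).2] at k
  rw [k]
  refine MeasureTheory.setIntegral_congr_fun measurableSet_Ioi fun x hx => ?_
  exact (leg_geom x hx _).symm
end

section
/- Ramanujan's formula: if n > 1 is an odd integer, then ∑_{k=1}^∞ k^{2n−1}/(e^{2πk} − 1) = b_{2n}/(4n), where b_{2n} is the Bernoulli number. -/
lemma E_at_I {n : ℕ} (hodd : Odd n) (hk : 3 ≤ 2 * n) :
    ModularForm.E hk UpperHalfPlane.I = 0 := by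
  have h0 : eisensteinSeries (N := 1) 0 ((2 * n : ℕ) : ℤ) UpperHalfPlane.I = 0 := by
    have h := congr_fun (EisensteinSeries.eisensteinSeries_slash_apply (N := 1) 0
      ((2 * n : ℕ) : ℤ) ModularGroup.S) UpperHalfPlane.I
    rw [SlashInvariantForm.slash_S_apply] at h
    have hI : UpperHalfPlane.mk _ UpperHalfPlane.I.im_inv_neg_coe_pos = UpperHalfPlane.I := by
      apply UpperHalfPlane.ext
      simp
    have hp : ((UpperHalfPlane.I : UpperHalfPlane) : ℂ) ^ (-((2 * n : ℕ) : ℤ)) = -1 := by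
      rw [zpow_neg, zpow_natCast, UpperHalfPlane.coe_I, pow_mul, Complex.I_sq, hodd.neg_one_pow]
      norm_num
    rw [hI, hp, Subsingleton.elim (Matrix.vecMul (0 : Fin 2 → ZMod 1) _) 0] at h
    linear_combination (-1 / 2) * h
  rw [show ModularForm.E hk UpperHalfPlane.I = (1 / 2 : ℂ) •
    EisensteinSeries.eisensteinSeriesSIF (N := 1) 0 ((2 * n : ℕ) : ℤ) UpperHalfPlane.I from rfl,
    EisensteinSeries.eisensteinSeriesSIF_apply, h0, smul_zero]

theorem ramanujan_formula (n : ℕ) (hodd : Odd n) (hn : 1 < n) :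
    ∑' k : ℕ, ((k : ℝ) + 1) ^ (2 * n - 1) / (Real.exp (2 * Real.pi * ((k : ℝ) + 1)) - 1)
      = ((bernoulli (2 * n) : ℚ) : ℝ) / (4 * n) := by
  have hk : 3 ≤ 2 * n := by omega
  have hE := E_at_I hodd hk
  rw [EisensteinSeries.q_expansion_bernoulli hk ⟨n, by ring⟩] at hE
  have hr := UpperHalfPlane.norm_exp_two_pi_I_lt_one UpperHalfPlane.I
  simp only [zpow_natCast] at hE
  rw [← tsum_pow_div_one_sub_eq_tsum_sigma hr,
    tsum_pnat_eq_tsum_succ (f := fun m : ℕ ↦ (m : ℂ) ^ (2 * n - 1) *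
      Complex.exp (2 * Real.pi * Complex.I * (UpperHalfPlane.I : UpperHalfPlane)) ^ m /
      (1 - Complex.exp (2 * Real.pi * Complex.I * (UpperHalfPlane.I : UpperHalfPlane)) ^ m))] at hE
  have hs : ∑' m : ℕ, ((m + 1 : ℕ) : ℂ) ^ (2 * n - 1) *
      Complex.exp (2 * Real.pi * Complex.I * (UpperHalfPlane.I : UpperHalfPlane)) ^ (m + 1) /
      (1 - Complex.exp (2 * Real.pi * Complex.I * (UpperHalfPlane.I : UpperHalfPlane)) ^ (m + 1))
      = ((∑' k : ℕ, ((k : ℝ) + 1) ^ (2 * n - 1) /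
        (Real.exp (2 * Real.pi * ((k : ℝ) + 1)) - 1) : ℝ) : ℂ) := by
    rw [Complex.ofReal_tsum]
    refine tsum_congr fun m ↦ ?_
    have he : Complex.exp (2 * Real.pi * Complex.I * (UpperHalfPlane.I : UpperHalfPlane)) ^ (m + 1)
        = (((Real.exp (2 * Real.pi * ((m : ℝ) + 1)))⁻¹ : ℝ) : ℂ) := by
      rw [← Complex.exp_nat_mul, ← Real.exp_neg, Complex.ofReal_exp, UpperHalfPlane.coe_I,
        mul_assoc _ Complex.I, Complex.I_mul_I]
      congr 1
      push_cast
      ring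
    rw [he]
    norm_cast
    have h1 : 1 < Real.exp (2 * Real.pi * ((m : ℝ) + 1)) :=
      Real.one_lt_exp_iff.mpr (by positivity)
    push_cast at h1 ⊢
    have h2 : Real.exp (2 * Real.pi * ((m : ℝ) + 1)) - 1 ≠ 0 := by linarith
    field_simp
  rw [hs] at hE
  have hE' : 1 - (2 * ((2 * n : ℕ) : ℝ) / ((bernoulli (2 * n) : ℚ) : ℝ)) *
    (∑' k : ℕ, ((k : ℝ) + 1) ^ (2 * n - 1) /
        (Real.exp (2 * Real.pi * ((k : ℝ) + 1)) - 1)) = 0 := by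
    exact_mod_cast hE
  have hb : ((bernoulli (2 * n) : ℚ) : ℝ) ≠ 0 := by
    intro h
    rw [h] at hE'
    simp at hE'
  have hn0 : (n : ℝ) ≠ 0 := by positivity
  generalize (∑' k : ℕ, ((k : ℝ) + 1) ^ (2 * n - 1) /
        (Real.exp (2 * Real.pi * ((k : ℝ) + 1)) - 1)) = S at hE' ⊢
  field_simp at hE' ⊢
  push_cast at hE'
  linarith
end
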